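/- Let σ₀ = I, σ₁ = X, σ₂ = Y, σ₃ = Z be the 2×2 identity and Pauli matrices over ℂ, where X = [[0,1],[1,0]], Y = [[0,−i],[i,0]], Z = [[1,0],[0,−1]]. For f : Fin D → Fin 4, let M_f be the D-fold Kronecker product σ_{f(0)} ⊗ ⋯ ⊗ σ_{f(D−1)}. Suppose ψ and δ are vectors in ℂ^(2^D) all of whose coordinates are real, and suppose the number of indices k with f(k) = 2 is even. Then the imaginary part of ⟨ψ, M_fᴴ δ⟩ vanishes; consequently the QITE coefficient b_f = −2·Im⟨ψ, M_fᴴ δ⟩ is zero. -/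

import Mathlib

open Complex
open scoped InnerProductSpace

/-- The identity and the three Pauli matrices: `σ₀ = I`, `σ₁ = X`, `σ₂ = Y`, `σ₃ = Z`. -/
noncomputable def pauli : Fin 4 → Matrix (Fin 2) (Fin 2) ℂ :=
  ![!![1, 0; 0, 1], !![0, 1; 1, 0], !![0, -I; I, 0], !![1, 0; 0, -1]]

/-- The `D`-fold Kronecker (tensor) product `σ_{f(0)} ⊗ σ_{f(1)} ⊗ ⋯ ⊗ σ_{f(D−1)}`,
with rows and columns indexed by bit strings; its `(i, j)` entry is
`∏ k, (σ_{f(k)})_{i(k), j(k)}`. -/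
noncomputable def pauliString {D : ℕ} (f : Fin D → Fin 4) :
    Matrix (Fin D → Fin 2) (Fin D → Fin 2) ℂ :=
  fun i j => ∏ k, pauli (f k) (i k) (j k)

theorem pauli_conj (a : Fin 4) (i j : Fin 2) :
    (starRingEnd ℂ) (pauli a i j) = (if a = 2 then -1 else 1) * pauli a i j := by
  fin_cases a <;> fin_cases i <;> fin_cases j <;> simp [pauli]

theorem pauliString_conj {D : ℕ} (f : Fin D → Fin 4)
    (hf : Even (Finset.univ.filter (fun k => f k = 2)).card) (i j : Fin D → Fin 2) :
    (starRingEnd ℂ) (pauliString f i j) = pauliString f i j := by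
  unfold pauliString
  rw [map_prod]
  simp only [pauli_conj]
  rw [Finset.prod_mul_distrib, Finset.prod_ite]
  simp [hf.neg_one_pow]

/-- If `ψ`, `δ` have real coordinates and the Pauli string `M_f` contains an even number
of `Y` factors, then `Im⟨ψ, M_fᴴ δ⟩ = 0`; hence the QITE coefficient
`b_f = −2·Im⟨ψ, M_fᴴ δ⟩` vanishes. -/
theorem qite_coefficient_vanishes_for_even_Y_count
    {D : ℕ} (f : Fin D → Fin 4)
    (ψ δ : EuclideanSpace ℂ (Fin D → Fin 2))
    (hψ : ∀ z, (ψ z).im = 0) (hδ : ∀ z, (δ z).im = 0)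
    (hf : Even (Finset.univ.filter (fun k => f k = 2)).card) :
    (⟪ψ, Matrix.toEuclideanLin (pauliString f).conjTranspose δ⟫_ℂ).im = 0 ∧
    -2 * (⟪ψ, Matrix.toEuclideanLin (pauliString f).conjTranspose δ⟫_ℂ).im = 0 := by
  have h : (⟪ψ, Matrix.toEuclideanLin (pauliString f).conjTranspose δ⟫_ℂ).im = 0 := by
    rw [← Complex.conj_eq_iff_im]
    have h1 : ∀ z, (starRingEnd ℂ) (ψ z) = ψ z := fun z => Complex.conj_eq_iff_im.2 (hψ z)
    have h2 : ∀ z, (starRingEnd ℂ) (δ z) = δ z := fun z => Complex.conj_eq_iff_im.2 (hδ z)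
    simp [PiLp.inner_apply, Matrix.toLpLin_apply, Matrix.mulVec, dotProduct,
      Matrix.conjTranspose_apply, h1, h2, pauliString_conj f hf]
  exact ⟨h, by rw [h, mul_zero]⟩
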